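/- Let λ ≥ 1, μ̄ > 2 be real, and let k, n be natural numbers. Then Σ_{0 ≤ j ≤ k} Σ_{0 ≤ i ≤ n} (λn + k + 2)^{μ̄} / ((λi + j + 1)^{μ̄} (λ(n - i) + k - j + 1)^{μ̄}) ≤ 2^{μ̄} Σ_{j ≥ 0} Σ_{i ≥ 0} 1/(λi + j + 1)^{μ̄}. -/

import Mathlib

open Finset

lemma summable_one_div_nat_add_one_rpow {s : ℝ} (hs : 1 < s) :
    Summable fun n : ℕ => 1 / ((n : ℝ) + 1) ^ s := by
  simpa using (summable_nat_add_iff 1).2 (Real.summable_one_div_nat_rpow.2 hs)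

lemma summable_one_div_mul_add_add_one_rpow {c s : ℝ} (hc : 1 ≤ c) (hs : 2 < s) :
    Summable fun p : ℕ × ℕ => 1 / (c * p.1 + p.2 + 1) ^ s := by
  have hsum := summable_one_div_nat_add_one_rpow (s := s / 2) (by linarith)
  refine Summable.of_nonneg_of_le (fun p => by positivity) (fun p => ?_)
    (hsum.mul_of_nonneg hsum (fun n => by positivity) (fun n => by positivity))
  obtain ⟨i, j⟩ := p
  have hi : (0 : ℝ) ≤ i := i.cast_nonneg
  have hj : (0 : ℝ) ≤ j := j.cast_nonneg
  have hci : (i : ℝ) ≤ c * i := le_mul_of_one_le_left hi hc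
  have hsq : (c * i + j + 1) ^ s = ((c * i + j + 1) ^ 2) ^ (s / 2) := by
    rw [← Real.rpow_natCast_mul (by positivity)]
    congr 1
    push_cast
    ring
  dsimp only
  rw [one_div_mul_one_div, hsq, ← Real.mul_rpow (by positivity) (by positivity)]
  refine one_div_le_one_div_of_le (by positivity)
    (Real.rpow_le_rpow (by positivity) ?_ (by linarith))
  calc ((i : ℝ) + 1) * (j + 1) ≤ (c * i + j + 1) * (c * i + j + 1) := by
        gcongr <;> linarith
    _ = (c * i + j + 1) ^ 2 := by ring

lemma add_rpow_div_rpow_mul_rpow_le {a b s : ℝ} (ha : 0 < a) (hb : 0 < b) (hs : 1 ≤ s) :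
    (a + b) ^ s / (a ^ s * b ^ s) ≤ 2 ^ (s - 1) * (1 / a ^ s + 1 / b ^ s) := by
  have has : 0 < a ^ s := Real.rpow_pos_of_pos ha s
  have hbs : 0 < b ^ s := Real.rpow_pos_of_pos hb s
  have h : (a + b) ^ s ≤ 2 ^ (s - 1) * (a ^ s + b ^ s) :=
    mod_cast NNReal.rpow_add_le_mul_rpow_add_rpow ⟨a, ha.le⟩ ⟨b, hb.le⟩ hs
  calc (a + b) ^ s / (a ^ s * b ^ s)
      ≤ 2 ^ (s - 1) * (a ^ s + b ^ s) / (a ^ s * b ^ s) := by gcongr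
    _ = 2 ^ (s - 1) * (1 / a ^ s + 1 / b ^ s) := by
        field_simp
        ring

theorem convexity_double_sum_bound (lam mu : ℝ) (hlam : 1 ≤ lam) (hmu : 2 < mu)
    (k n : ℕ) :
    ∑ j ∈ Finset.range (k + 1), ∑ i ∈ Finset.range (n + 1),
        (lam * n + k + 2) ^ mu /
          ((lam * i + j + 1) ^ mu * (lam * ((n : ℝ) - i) + ((k : ℝ) - j) + 1) ^ mu) ≤
      2 ^ mu * ∑' p : ℕ × ℕ, 1 / (lam * p.1 + p.2 + 1) ^ mu := by
  set f : ℕ × ℕ → ℝ := fun p => 1 / (lam * p.1 + p.2 + 1) ^ mu with hf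
  set S : ℝ := ∑ j ∈ range (k + 1), ∑ i ∈ range (n + 1), f (i, j) with hS
  have hS_le : S ≤ ∑' p, f p := by
    rw [hS, sum_comm, ← sum_product']
    exact (summable_one_div_mul_add_add_one_rpow hlam hmu).sum_le_tsum _
      fun p _ => by positivity
  have hS_flip : ∑ j ∈ range (k + 1), ∑ i ∈ range (n + 1), f (n - i, k - j) = S := by
    rw [hS, ← sum_flip fun j => ∑ i ∈ range (n + 1), f (i, j)]
    refine sum_congr rfl fun j _ => ?_
    rw [← sum_flip fun i => f (i, k - j)]
  have hterm : ∀ j ∈ range (k + 1), ∀ i ∈ range (n + 1),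
      (lam * n + k + 2) ^ mu /
          ((lam * i + j + 1) ^ mu * (lam * ((n : ℝ) - i) + ((k : ℝ) - j) + 1) ^ mu) ≤
        2 ^ (mu - 1) * (f (i, j) + f (n - i, k - j)) := by
    intro j hj i hi
    have hjk : j ≤ k := mem_range_succ_iff.1 hj
    have hin : i ≤ n := mem_range_succ_iff.1 hi
    have h := add_rpow_div_rpow_mul_rpow_le (a := lam * i + j + 1)
      (b := lam * (n - i : ℕ) + (k - j : ℕ) + 1) (s := mu)
      (by positivity) (by positivity) (by linarith)
    simp only [hf]
    rw [← Nat.cast_sub hin, ← Nat.cast_sub hjk]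
    convert h using 3
    push_cast [hin, hjk]
    ring
  calc _ ≤ ∑ j ∈ range (k + 1), ∑ i ∈ range (n + 1),
          2 ^ (mu - 1) * (f (i, j) + f (n - i, k - j)) :=
        sum_le_sum fun j hj => sum_le_sum fun i hi => hterm j hj i hi
    _ = 2 ^ (mu - 1) * (S + S) := by
        simp_rw [← mul_sum, sum_add_distrib]
        rw [hS_flip]
    _ = 2 ^ mu * S := by
        rw [Real.rpow_sub_one two_ne_zero]
        ring
    _ ≤ 2 ^ mu * ∑' p, f p := by gcongr
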